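/- Suppose √f = [a₀; overline(a₁,…,a_{m−1}, aₘ, a_{m−1},…,a₁, 2a₀)] with aₘ = a₀ or a₀ − 1, and let (c, h) be the fundamental solution of c² − f·h² = 1. If m is odd then c − 1 = A_{m−1}(Bₘ + B_{m−2}); if m is even then c + 1 = A_{m−1}(Bₘ + B_{m−2}). -/

import Mathlib

/-- The pair `(rₖ, sₖ)` of the continued fraction algorithm for `√f`:
`r₀ = 0`, `s₀ = 1`, `r_{k+1} = aₖ sₖ − rₖ`, `s_{k+1} = (f − r_{k+1}²)/sₖ`,
where `aₖ = ⌊(√f + rₖ)/sₖ⌋ = ⌊(⌊√f⌋ + rₖ)/sₖ⌋`. -/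
def cfRS (f : ℕ) : ℕ → ℤ × ℤ
  | 0 => (0, 1)
  | k + 1 =>
    let p := cfRS f k
    let a := Int.fdiv ((Nat.sqrt f : ℤ) + p.1) p.2
    let r' := a * p.2 - p.1
    (r', Int.fdiv ((f : ℤ) - r' ^ 2) p.2)

/-- The `k`-th partial quotient `aₖ` of the continued fraction of `√f`. -/
def cfA (f : ℕ) (k : ℕ) : ℤ :=
  Int.fdiv ((Nat.sqrt f : ℤ) + (cfRS f k).1) (cfRS f k).2

/-- Numerators of the convergents of `√f`, shifted by 2:
`cfNum f (k+2) = Aₖ`, with `A₋₂ = 0`, `A₋₁ = 1`. -/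
def cfNum (f : ℕ) : ℕ → ℤ
  | 0 => 0
  | 1 => 1
  | k + 2 => cfA f k * cfNum f (k + 1) + cfNum f k

/-- Denominators of the convergents of `√f`, shifted by 2:
`cfDen f (k+2) = Bₖ`, with `B₋₂ = 1`, `B₋₁ = 0`. -/
def cfDen (f : ℕ) : ℕ → ℤ
  | 0 => 1
  | 1 => 0
  | k + 2 => cfA f k * cfDen f (k + 1) + cfDen f k

/-- `p` is a period of the (eventually periodic) partial quotient sequence of `√f`. -/
def CFIsPeriod (f p : ℕ) : Prop :=
  0 < p ∧ ∀ k, 1 ≤ k → cfA f (k + p) = cfA f k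

/-- `p` is the (minimal) period of the continued fraction expansion of `√f`. -/
def CFPeriod (f p : ℕ) : Prop :=
  CFIsPeriod f p ∧ ∀ q, CFIsPeriod f q → p ≤ q

/-- `(c, h)` is the fundamental (smallest positive) solution of `c² − f h² = 1`. -/
def IsFundamentalPell (f : ℕ) (c h : ℤ) : Prop :=
  0 < c ∧ 0 < h ∧ c ^ 2 - (f : ℤ) * h ^ 2 = 1 ∧
    ∀ c' h' : ℤ, 0 < c' → 0 < h' → c' ^ 2 - (f : ℤ) * h' ^ 2 = 1 → c ≤ c'

theorem sq_natSqrt_lt {f : ℕ} (hns : ¬ IsSquare f) : ((Nat.sqrt f : ℕ) : ℤ) ^ 2 < f := by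
  have h1 : Nat.sqrt f ^ 2 ≤ f := Nat.sqrt_le' f
  have h2 : Nat.sqrt f ^ 2 ≠ f := fun h => hns ⟨Nat.sqrt f, by rw [← sq, h]⟩
  exact_mod_cast lt_of_le_of_ne h1 h2

theorem lt_sq_natSqrt_add_one (f : ℕ) : (f : ℤ) < ((Nat.sqrt f : ℕ) + 1 : ℤ) ^ 2 := by
  exact_mod_cast Nat.lt_succ_sqrt' f

theorem one_le_natSqrt {f : ℕ} (hf : 0 < f) : (1 : ℤ) ≤ (Nat.sqrt f : ℕ) := by
  exact_mod_cast Nat.sqrt_pos.2 hf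

theorem cfRS_succ_fst (f k : ℕ) :
    (cfRS f (k + 1)).1 = cfA f k * (cfRS f k).2 - (cfRS f k).1 := rfl

theorem cfRS_succ_snd (f k : ℕ) :
    (cfRS f (k + 1)).2 =
      Int.fdiv ((f : ℤ) - (cfRS f (k + 1)).1 ^ 2) (cfRS f k).2 := rfl

theorem cfNum_add_two (f k : ℕ) :
    cfNum f (k + 2) = cfA f k * cfNum f (k + 1) + cfNum f k := rfl

theorem cfDen_add_two (f k : ℕ) :
    cfDen f (k + 2) = cfA f k * cfDen f (k + 1) + cfDen f k := rfl

theorem cfRS_zero (f : ℕ) : cfRS f 0 = (0, 1) := rfl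

theorem cfA_bounds {f k : ℕ} (hs : 0 < (cfRS f k).2) :
    cfA f k * (cfRS f k).2 ≤ (Nat.sqrt f : ℤ) + (cfRS f k).1 ∧
      (Nat.sqrt f : ℤ) + (cfRS f k).1 < cfA f k * (cfRS f k).2 + (cfRS f k).2 := by
  unfold cfA
  rw [Int.fdiv_eq_ediv_of_nonneg _ hs.le]
  refine ⟨Int.ediv_mul_le _ hs.ne', ?_⟩
  have := Int.lt_ediv_add_one_mul_self ((Nat.sqrt f : ℤ) + (cfRS f k).1) hs
  linarith

theorem cfA_zero (f : ℕ) : cfA f 0 = Nat.sqrt f := by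
  simp [cfA, cfRS_zero]

/-- The bounds satisfied by every pair `(rₖ, sₖ)`. -/
def CFAdmissible (f : ℕ) (p : ℤ × ℤ) : Prop :=
  0 < p.2 ∧ 0 ≤ p.1 ∧ p.1 ≤ (Nat.sqrt f : ℤ) ∧ p.2 ≤ (Nat.sqrt f : ℤ) + p.1 ∧
    p.2 ∣ (f : ℤ) - p.1 ^ 2

theorem one_le_cfA_of_admissible {f k : ℕ} (h : CFAdmissible f (cfRS f k)) : 1 ≤ cfA f k := by
  obtain ⟨hs, -, -, hle, -⟩ := h
  have := (cfA_bounds hs).2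
  by_contra hlt
  have : cfA f k ≤ 0 := by omega
  nlinarith

theorem cfRS_mul_succ_of_admissible {f k : ℕ} (h : CFAdmissible f (cfRS f k)) :
    (cfRS f k).2 * (cfRS f (k + 1)).2 = (f : ℤ) - (cfRS f (k + 1)).1 ^ 2 := by
  obtain ⟨hs, -, -, -, hdvd⟩ := h
  have hd : (cfRS f k).2 ∣ (f : ℤ) - (cfRS f (k + 1)).1 ^ 2 := by
    have e : (f : ℤ) - (cfRS f (k + 1)).1 ^ 2 = ((f : ℤ) - (cfRS f k).1 ^ 2) +
        (cfRS f k).2 * (cfA f k * (2 * (cfRS f k).1 - cfA f k * (cfRS f k).2)) := by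
      rw [cfRS_succ_fst]; ring
    rw [e]
    exact dvd_add hdvd (dvd_mul_right _ _)
  rw [cfRS_succ_snd, Int.fdiv_eq_ediv_of_nonneg _ hs.le, Int.mul_ediv_cancel' hd]

theorem cfRS_succ_admissible {f k : ℕ} (hns : ¬ IsSquare f) (h : CFAdmissible f (cfRS f k)) :
    CFAdmissible f (cfRS f (k + 1)) ∧
      (Nat.sqrt f : ℤ) - (cfRS f (k + 1)).1 < (cfRS f (k + 1)).2 := by
  have hmul := cfRS_mul_succ_of_admissible h
  have ha := one_le_cfA_of_admissible h
  obtain ⟨hs, hr0, hrd, hle, -⟩ := h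
  have hb := cfA_bounds hs
  have hr' := cfRS_succ_fst f k
  have hd1 := sq_natSqrt_lt hns
  have hd2 := lt_sq_natSqrt_add_one f
  unfold CFAdmissible
  generalize (cfRS f (k + 1)).1 = r' at *
  generalize (cfRS f (k + 1)).2 = s' at *
  generalize (cfRS f k).1 = r at *
  generalize (cfRS f k).2 = s at *
  generalize cfA f k = a at *
  generalize (Nat.sqrt f : ℤ) = d at *
  generalize (f : ℤ) = F at *
  have has : s ≤ a * s := by nlinarith
  have hr'd : r' ≤ d := by linarith
  have hr'0 : 0 < r' := by
    rcases le_or_gt s d with hsd | hsd <;> linarith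
  have hs' : 0 < s' := by
    by_contra hneg
    nlinarith [mul_nonneg hs.le (by linarith : 0 ≤ -s')]
  refine ⟨⟨hs', hr'0.le, hr'd, ?_, ⟨s, by linarith⟩⟩, ?_⟩
  · by_contra hlt
    have h1 : d + r' + 1 ≤ s' := by linarith
    have h2 : d + 1 - r' ≤ s := by linarith
    nlinarith [mul_le_mul h2 h1 (by linarith) hs.le]
  · by_contra hlt
    have h1 : s' ≤ d - r' := by linarith
    have h2 : s ≤ d + r' := by linarith
    nlinarith [mul_le_mul h2 h1 hs'.le (by linarith)]

theorem cfRS_admissible {f : ℕ} (hf : 0 < f) (hns : ¬ IsSquare f) (k : ℕ) :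
    CFAdmissible f (cfRS f k) := by
  induction k with
  | zero => simpa [CFAdmissible, cfRS_zero] using one_le_natSqrt hf
  | succ k ih => exact (cfRS_succ_admissible hns ih).1

theorem one_le_cfA {f : ℕ} (hf : 0 < f) (hns : ¬ IsSquare f) (k : ℕ) : 1 ≤ cfA f k :=
  one_le_cfA_of_admissible (cfRS_admissible hf hns k)

theorem cfRS_mul_succ {f : ℕ} (hf : 0 < f) (hns : ¬ IsSquare f) (k : ℕ) :
    (cfRS f k).2 * (cfRS f (k + 1)).2 = (f : ℤ) - (cfRS f (k + 1)).1 ^ 2 :=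
  cfRS_mul_succ_of_admissible (cfRS_admissible hf hns k)

theorem cfRS_snd_eq_one_of_cfA {f k : ℕ} (hf : 0 < f) (hns : ¬ IsSquare f)
    (h : cfA f k = 2 * cfA f 0) : (cfRS f k).2 = 1 := by
  obtain ⟨hs, -, hrd, -, -⟩ := cfRS_admissible hf hns k
  have hb := (cfA_bounds hs).1
  rw [h, cfA_zero] at hb
  have hd := one_le_natSqrt hf
  by_contra hne
  have : 2 ≤ (cfRS f k).2 := by omega
  nlinarith

theorem cfIsPeriod_of_cfRS_snd_eq_one {f k : ℕ} (hf : 0 < f) (hns : ¬ IsSquare f)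
    (h : (cfRS f (k + 1)).2 = 1) : CFIsPeriod f (k + 1) := by
  have hadm := cfRS_admissible hf hns (k + 1)
  have hlt := (cfRS_succ_admissible hns (cfRS_admissible hf hns k)).2
  have hr : (cfRS f (k + 1)).1 = Nat.sqrt f := by
    obtain ⟨-, -, hrd, -, -⟩ := hadm
    omega
  have hrs : ∀ j, cfRS f (j + 1 + (k + 1)) = cfRS f (j + 1) := by
    intro j
    induction j with
    | zero =>
      have e : 0 + 1 + (k + 1) = k + 1 + 1 := by ring
      have hfst : (cfRS f (k + 1 + 1)).1 = (cfRS f (0 + 1)).1 := by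
        rw [cfRS_succ_fst f (k + 1), cfRS_succ_fst f 0, cfA_zero, cfA, h, hr, cfRS_zero]
        simp
      rw [e]
      refine Prod.ext hfst ?_
      rw [cfRS_succ_snd f (k + 1), cfRS_succ_snd f 0, hfst, h, cfRS_zero]
    | succ j ih =>
      have e : j + 1 + 1 + (k + 1) = j + 1 + (k + 1) + 1 := by ring
      rw [e, cfRS, ih, ← cfRS]
  refine ⟨k.succ_pos, fun j hj => ?_⟩
  obtain ⟨i, rfl⟩ := Nat.exists_eq_add_of_le' hj
  rw [cfA, hrs, ← cfA]

theorem cfNum_mul_cfDen_sub (f k : ℕ) :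
    cfNum f (k + 1) * cfDen f k - cfNum f k * cfDen f (k + 1) = (-1) ^ k := by
  induction k with
  | zero => simp [cfNum, cfDen]
  | succ k ih =>
    rw [cfNum_add_two, cfDen_add_two, pow_succ, ← ih]
    ring

theorem cfNum_cfDen_linear {f : ℕ} (hf : 0 < f) (hns : ¬ IsSquare f) (k : ℕ) :
    cfNum f (k + 1) * (cfRS f k).1 + cfNum f k * (cfRS f k).2 = f * cfDen f (k + 1) ∧
      cfDen f (k + 1) * (cfRS f k).1 + cfDen f k * (cfRS f k).2 = cfNum f (k + 1) := by
  induction k with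
  | zero => simp [cfNum, cfDen, cfRS_zero]
  | succ k ih =>
    obtain ⟨h1, h2⟩ := ih
    have hs := (cfRS_admissible hf hns k).1
    have hmul := cfRS_mul_succ hf hns k
    have hr := cfRS_succ_fst f k
    have hN : cfNum f (k + 2) * (cfRS f k).2 =
        (cfRS f (k + 1)).1 * cfNum f (k + 1) + f * cfDen f (k + 1) := by
      rw [cfNum_add_two, hr]; linear_combination h1
    have hD : cfDen f (k + 2) * (cfRS f k).2 =
        (cfRS f (k + 1)).1 * cfDen f (k + 1) + cfNum f (k + 1) := by
      rw [cfDen_add_two, hr]; linear_combination h2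
    constructor
    · apply mul_right_cancel₀ hs.ne'
      linear_combination (cfRS f (k + 1)).1 * hN + cfNum f (k + 1) * hmul - f * hD
    · apply mul_right_cancel₀ hs.ne'
      linear_combination (cfRS f (k + 1)).1 * hD + cfDen f (k + 1) * hmul - hN

theorem cfNum_sq_sub {f : ℕ} (hf : 0 < f) (hns : ¬ IsSquare f) (k : ℕ) :
    cfNum f (k + 1) ^ 2 - f * cfDen f (k + 1) ^ 2 = (-1) ^ k * (cfRS f k).2 := by
  obtain ⟨h1, h2⟩ := cfNum_cfDen_linear hf hns k
  rw [← cfNum_mul_cfDen_sub f k]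
  linear_combination cfDen f (k + 1) * h1 - cfNum f (k + 1) * h2

theorem cfNum_nonneg {f : ℕ} (hf : 0 < f) (hns : ¬ IsSquare f) (k : ℕ) :
    0 ≤ cfNum f k ∧ 1 ≤ cfNum f (k + 1) := by
  induction k with
  | zero => simp [cfNum]
  | succ k ih =>
    have := one_le_cfA hf hns k
    refine ⟨by linarith [ih.2], ?_⟩
    rw [cfNum_add_two]
    nlinarith [ih.1, ih.2]

theorem cfDen_nonneg {f : ℕ} (hf : 0 < f) (hns : ¬ IsSquare f) (k : ℕ) :
    0 ≤ cfDen f (k + 1) ∧ 1 ≤ cfDen f (k + 2) := by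
  induction k with
  | zero => simp [cfDen]
  | succ k ih =>
    have := one_le_cfA hf hns (k + 1)
    refine ⟨by linarith [ih.2], ?_⟩
    rw [cfDen_add_two]
    nlinarith [ih.1, ih.2]

theorem cfNum_monotone {f : ℕ} (hf : 0 < f) (hns : ¬ IsSquare f) : Monotone (cfNum f) := by
  refine monotone_nat_of_le_succ fun k => ?_
  cases k with
  | zero => simp [cfNum]
  | succ k =>
    have := one_le_cfA hf hns k
    have := cfNum_nonneg hf hns k
    rw [cfNum_add_two]
    nlinarith

/-- The `k`-th complete quotient of the continued fraction of `√f`. -/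
noncomputable def cfQuot (f k : ℕ) : ℝ := (√f + (cfRS f k).1) / (cfRS f k).2

theorem floor_cfQuot {f : ℕ} (hf : 0 < f) (hns : ¬ IsSquare f) (k : ℕ) :
    ⌊cfQuot f k⌋ = cfA f k := by
  have hs := (cfRS_admissible hf hns k).1
  have hsR : (0 : ℝ) < (cfRS f k).2 := by exact_mod_cast hs
  obtain ⟨h1, h2⟩ := cfA_bounds hs
  have h1R : (cfA f k * (cfRS f k).2 : ℝ) ≤ (Nat.sqrt f : ℝ) + (cfRS f k).1 := by
    exact_mod_cast h1
  have h2R : (Nat.sqrt f : ℝ) + (cfRS f k).1 + 1 ≤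
      (cfA f k * (cfRS f k).2 + (cfRS f k).2 : ℝ) := by
    exact_mod_cast h2
  have hd1 : (Nat.sqrt f : ℝ) ≤ √f := Real.nat_sqrt_le_real_sqrt
  have hd2 : √f < (Nat.sqrt f : ℝ) + 1 := Real.real_sqrt_lt_nat_sqrt_succ
  rw [Int.floor_eq_iff, cfQuot, le_div_iff₀ hsR, div_lt_iff₀ hsR]
  constructor <;> nlinarith

theorem fract_cfQuot_inv {f : ℕ} (hf : 0 < f) (hns : ¬ IsSquare f) (k : ℕ) :
    (Int.fract (cfQuot f k))⁻¹ = cfQuot f (k + 1) := by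
  have hsR : (0 : ℝ) < (cfRS f k).2 := by exact_mod_cast (cfRS_admissible hf hns k).1
  have hsR' : (0 : ℝ) < (cfRS f (k + 1)).2 := by
    exact_mod_cast (cfRS_admissible hf hns (k + 1)).1
  have hmul : ((cfRS f k).2 * (cfRS f (k + 1)).2 : ℝ) = f - (cfRS f (k + 1)).1 ^ 2 := by
    exact_mod_cast cfRS_mul_succ hf hns k
  have hr : ((cfRS f (k + 1)).1 : ℝ) = cfA f k * (cfRS f k).2 - (cfRS f k).1 := by
    exact_mod_cast cfRS_succ_fst f k
  have hsq : √(f : ℝ) ^ 2 = f := Real.sq_sqrt (Nat.cast_nonneg f)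
  apply inv_eq_of_mul_eq_one_right
  rw [Int.fract, floor_cfQuot hf hns, cfQuot, cfQuot]
  field_simp
  linear_combination (√(f : ℝ) + (cfRS f (k + 1)).1) * hr - hmul + hsq

theorem convergent_cfQuot_pos {f : ℕ} (hf : 0 < f) (hns : ¬ IsSquare f) (n k : ℕ) :
    0 < (cfQuot f k).convergent n := by
  have ha (k : ℕ) : (1 : ℚ) ≤ cfA f k := by exact_mod_cast one_le_cfA hf hns k
  induction n generalizing k with
  | zero => rw [Real.convergent_zero, floor_cfQuot hf hns]; linarith [ha k]
  | succ n ih =>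
    rw [Real.convergent_succ, floor_cfQuot hf hns, fract_cfQuot_inv hf hns]
    have := inv_pos.2 (ih (k + 1))
    linarith [ha k]

theorem cfNum_mul_eq_cfDen_mul_convergent {f : ℕ} (hf : 0 < f) (hns : ¬ IsSquare f) (n k : ℕ) :
    (cfNum f (k + n + 2) : ℚ) *
        (cfDen f (k + 1) * (cfQuot f k).convergent n + cfDen f k) =
      cfDen f (k + n + 2) *
        (cfNum f (k + 1) * (cfQuot f k).convergent n + cfNum f k) := by
  induction n generalizing k with
  | zero =>
    rw [Real.convergent_zero, floor_cfQuot hf hns, add_zero, cfNum_add_two, cfDen_add_two]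
    push_cast
    ring
  | succ n ih =>
    have hpos := convergent_cfQuot_pos hf hns n (k + 1)
    have h := ih (k + 1)
    have e : k + (n + 1) + 2 = k + 1 + n + 2 := by ring
    rw [cfNum_add_two f k, cfDen_add_two f k] at h
    rw [Real.convergent_succ, floor_cfQuot hf hns, fract_cfQuot_inv hf hns, e]
    push_cast at h
    field_simp
    linear_combination h

theorem cfNum_eq_cfDen_mul_convergent {f : ℕ} (hf : 0 < f) (hns : ¬ IsSquare f) (n : ℕ) :
    (cfNum f (n + 2) : ℚ) = cfDen f (n + 2) * (√f).convergent n := by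
  have h := cfNum_mul_eq_cfDen_mul_convergent hf hns n 0
  simpa [cfQuot, cfRS_zero, cfNum, cfDen] using h

theorem exists_convergent_of_pell {f : ℕ} (hf : 0 < f) {x y : ℤ} (hx : 0 < x) (hy : 0 < y)
    (h : x ^ 2 - (f : ℤ) * y ^ 2 = 1) : ∃ n, (x : ℚ) / y = (√f).convergent n := by
  have hxR : (0 : ℝ) < x := by exact_mod_cast hx
  have hyR : (0 : ℝ) < y := by exact_mod_cast hy
  have hR : (x : ℝ) ^ 2 - f * y ^ 2 = 1 := by exact_mod_cast h
  have hsq : √(f : ℝ) ^ 2 = f := Real.sq_sqrt (Nat.cast_nonneg f)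
  have hs1 : (1 : ℝ) ≤ √f := Real.one_le_sqrt.2 (by exact_mod_cast hf)
  have hcop : IsCoprime x y := ⟨x, -(f * y), by linear_combination h⟩
  have hden : (((x : ℚ) / y).den : ℤ) = y :=
    Rat.den_div_eq_of_coprime hy (Int.isCoprime_iff_nat_coprime.1 hcop)
  have hdenR : ((((x : ℚ) / y).den : ℕ) : ℝ) = y := by
    exact_mod_cast congrArg (Int.cast : ℤ → ℝ) hden
  apply Real.exists_rat_eq_convergent
  rw [hdenR]
  push_cast
  have hprod : ((x : ℝ) - √f * y) * (x + √f * y) = 1 := by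
    linear_combination hR - y ^ 2 * hsq
  have hgt : √f * y < (x : ℝ) := by
    by_contra hle
    nlinarith [mul_nonneg (by linarith : 0 ≤ √f * y - (x : ℝ))
      (by positivity : 0 ≤ (x : ℝ) + √f * y)]
  have hbig : 2 * (y : ℝ) < x + √f * y := by nlinarith
  have habs : |√f - (x : ℝ) / y| = ((x : ℝ) - √f * y) / y := by
    rw [abs_sub_comm, abs_of_pos]
    · field_simp
    · rw [sub_pos, lt_div_iff₀ hyR]; exact hgt
  rw [habs, div_lt_div_iff₀ hyR (by positivity)]
  nlinarith [mul_lt_mul_of_pos_left hbig (mul_pos (sub_pos.2 hgt) hyR)]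

theorem exists_cfNum_eq_of_pell {f : ℕ} (hf : 0 < f) (hns : ¬ IsSquare f) {x y : ℤ}
    (hx : 0 < x) (hy : 0 < y) (h : x ^ 2 - (f : ℤ) * y ^ 2 = 1) :
    ∃ n, x = cfNum f (n + 2) ∧ y = cfDen f (n + 2) := by
  obtain ⟨n, hn⟩ := exists_convergent_of_pell hf hx hy h
  have hN := (cfNum_nonneg hf hns (n + 1)).2
  have hD := (cfDen_nonneg hf hns n).2
  have hyQ : (y : ℚ) ≠ 0 := by exact_mod_cast hy.ne'
  have hcross : cfNum f (n + 2) * y = cfDen f (n + 2) * x := by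
    have := cfNum_eq_cfDen_mul_convergent hf hns n
    rw [← hn] at this
    field_simp at this
    exact_mod_cast this
  have hdet := cfNum_mul_cfDen_sub f (n + 1)
  have hsq1 : ((-1 : ℤ) ^ (n + 1)) * (-1) ^ (n + 1) = 1 := by
    rw [← mul_pow]; norm_num
  have hcop : IsCoprime x y := ⟨x, -(f * y), by linear_combination h⟩
  have hcop' : IsCoprime (cfNum f (n + 2)) (cfDen f (n + 2)) :=
    ⟨(-1) ^ (n + 1) * cfDen f (n + 1), -((-1) ^ (n + 1) * cfNum f (n + 1)), by
      linear_combination (-1) ^ (n + 1) * hdet + hsq1⟩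
  have hxN : x = cfNum f (n + 2) :=
    Int.dvd_antisymm hx.le (by linarith)
      (hcop.dvd_of_dvd_mul_right ⟨cfDen f (n + 2), by linear_combination hcross⟩)
      (hcop'.dvd_of_dvd_mul_left ⟨y, by linear_combination -hcross⟩)
  refine ⟨n, hxN, ?_⟩
  rw [← hxN] at hcross
  exact mul_left_cancel₀ hx.ne' (by linear_combination hcross)

theorem CFPeriod.le_of_pell {f p : ℕ} (hf : 0 < f) (hns : ¬ IsSquare f) (hp : CFPeriod f p)
    {x y : ℤ} (hx : 0 < x) (hy : 0 < y) (h : x ^ 2 - (f : ℤ) * y ^ 2 = 1) :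
    cfNum f (p + 1) ≤ x := by
  obtain ⟨n, rfl, rfl⟩ := exists_cfNum_eq_of_pell hf hns hx hy h
  rw [cfNum_sq_sub hf hns] at h
  have hs := (cfRS_admissible hf hns (n + 1)).1
  have h1 : (cfRS f (n + 1)).2 = 1 := by
    rcases neg_one_pow_eq_or ℤ (n + 1) with e | e <;> rw [e] at h <;> linarith
  have := hp.2 _ (cfIsPeriod_of_cfRS_snd_eq_one hf hns h1)
  exact cfNum_monotone hf hns (by omega)

theorem fundamentalPell_eq_cfNum {f m : ℕ} (hf : 0 < f) (hns : ¬ IsSquare f) (hm : 1 ≤ m)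
    (hper : CFPeriod f (2 * m)) (hend : cfA f (2 * m) = 2 * cfA f 0) {c h : ℤ}
    (hfund : IsFundamentalPell f c h) : c = cfNum f (2 * m + 1) := by
  obtain ⟨hc, hh, hpell, hmin⟩ := hfund
  refine le_antisymm (hmin _ (cfDen f (2 * m + 1)) ?_ ?_ ?_) (hper.le_of_pell hf hns hc hh hpell)
  · linarith [(cfNum_nonneg hf hns (2 * m)).2]
  · have := (cfDen_nonneg hf hns (2 * m - 1)).2
    rw [show 2 * m - 1 + 2 = 2 * m + 1 by omega] at this
    linarith
  · rw [cfNum_sq_sub hf hns, cfRS_snd_eq_one_of_cfA hf hns hend]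
    simp

theorem cfNum_palindrome {f m : ℕ}
    (hpal : ∀ i, 1 ≤ i → i ≤ 2 * m - 1 → cfA f i = cfA f (2 * m - i)) (i j : ℕ)
    (hij : i + j + 1 = m) :
    cfNum f (m + j + 2) * cfDen f (i + 2) + cfNum f (m + j + 1) * cfDen f (i + 1) =
      cfNum f (2 * m + 1) := by
  induction i generalizing j with
  | zero =>
    have e : m + j + 2 = 2 * m + 1 := by omega
    rw [e]
    simp [cfDen]
  | succ i ih =>
    have h := ih (j + 1) (by omega)
    have ha := hpal (i + 1) (by omega) (by omega)
    rw [show 2 * m - (i + 1) = m + j + 1 by omega] at ha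
    rw [← h, ← add_assoc, cfNum_add_two f (m + j + 1), cfDen_add_two f (i + 1), ha]
    ring

theorem stmt_16 (f m : ℕ) (hf : 0 < f) (hns : ¬ IsSquare f) (hm : 1 ≤ m)
    (hper : CFPeriod f (2 * m)) (hend : cfA f (2 * m) = 2 * cfA f 0)
    (hpal : ∀ i, 1 ≤ i → i ≤ 2 * m - 1 → cfA f i = cfA f (2 * m - i))
    (ham : cfA f m = cfA f 0 ∨ cfA f m = cfA f 0 - 1)
    (c h : ℤ) (hfund : IsFundamentalPell f c h) :
    (Odd m → c - 1 = cfNum f (m + 1) * (cfDen f (m + 2) + cfDen f m)) ∧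
      (Even m → c + 1 = cfNum f (m + 1) * (cfDen f (m + 2) + cfDen f m)) := by
  obtain rfl := fundamentalPell_eq_cfNum hf hns hm hper hend hfund
  obtain ⟨n, rfl⟩ := Nat.exists_eq_add_of_le' hm
  have hp := cfNum_palindrome hpal n 0 (by omega)
  have hdet := cfNum_mul_cfDen_sub f (n + 1 + 1)
  simp only [add_zero] at hp
  constructor <;> intro hpar
  · rw [(Odd.add_one hpar).neg_one_pow] at hdet
    linear_combination hdet - hp
  · rw [(Even.add_one hpar).neg_one_pow] at hdet
    linear_combination hdet - hp
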